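/- Let q ≥ 1 and n > 2q, and let Ω ⊆ ℝⁿ be an open set containing the closed unit ball. Let ρ : [0,∞) → [0,∞) be continuously differentiable with ρ′(s) ≤ 0 for all s ≥ 0. Let ω be a measurable family of alternating q-forms on Ω \ {0} such that e(Q) is integrable on the unit ball (locally finite energy). Assume the first-variation identity holds only for radial test functions vanishing near the origin: for every smooth nonnegative nonincreasing η : [0,∞) → ℝ with compact support in [0,1) and every smooth ζ : [0,∞) → [0,1] that vanishes on a neighborhood of 0 and equals 1 outside a compact neighborhood of 0, the function φ(r) = ζ(r)·η(r) satisfies ∫_{B₁} e(Q(x)) (n·φ(|x|) + |x|·φ′(|x|)) dx = 2q ∫_{B₁} Q(x) ρ(Q(x)) φ(|x|) dx + 2q ∫_{B₁} ρ(Q(x)) |x| φ′(|x|) ‖∂_r⌟ω(x)‖² dx. Then for all 0 < r₁ < r₂ ≤ 1, r₁^{2q−n} ∫_{B_{r₁}} e(Q(x)) dx ≤ r₂^{2q−n} ∫_{B_{r₂}} e(Q(x)) dx. -/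

import Mathlib

open MeasureTheory Metric

/-- The squared norm of an alternating `q`-linear form on `ℝⁿ` induced by the standard
inner product: `Q = Σ_{i₁<⋯<i_q} ω(e_{i₁},…,e_{i_q})²`. -/
noncomputable def altNormSq {n q : ℕ}
    (α : AlternatingMap ℝ (EuclideanSpace ℝ (Fin n)) ℝ (Fin q)) : ℝ :=
  ∑ f ∈ Finset.univ.filter (fun f : Fin q → Fin n => ∀ i j : Fin q, i < j → f i < f j),
    (α fun i => EuclideanSpace.single (f i) (1:ℝ)) ^ 2

/-- The squared norm of the contraction `u⌟α` of an alternating `q`-linear form `α`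
with a vector `u`, i.e. of the `(q−1)`-form `(v₂,…,v_q) ↦ α(u, v₂, …, v_q)`. -/
noncomputable def contrNormSq {n q : ℕ} (u : EuclideanSpace ℝ (Fin n))
    (α : AlternatingMap ℝ (EuclideanSpace ℝ (Fin n)) ℝ (Fin q)) : ℝ :=
  ∑ g ∈ Finset.univ.filter
      (fun g : Fin (q - 1) → Fin n => ∀ i j : Fin (q - 1), i < j → g i < g j),
    (α fun i : Fin q => if h : (i : ℕ) = 0 then u
        else EuclideanSpace.single (g ⟨(i : ℕ) - 1, by have := i.isLt; omega⟩) (1:ℝ)) ^ 2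

/-- The nonlinear Hodge energy density `e(s) = ∫₀ˢ ρ(t) dt`. -/
noncomputable def hodgeE (ρ : ℝ → ℝ) (s : ℝ) : ℝ := ∫ t in (0:ℝ)..s, ρ t

open Filter Topology

section Algebra

variable {n q : ℕ}

lemma altNormSq_nonneg (α : AlternatingMap ℝ (EuclideanSpace ℝ (Fin n)) ℝ (Fin q)) :
    0 ≤ altNormSq α :=
  Finset.sum_nonneg fun _ _ => sq_nonneg _

/-- Every component of an alternating form on a tuple of standard basis vectors is bounded by
its norm. -/
lemma sq_apply_single_le_altNormSq
    (α : AlternatingMap ℝ (EuclideanSpace ℝ (Fin n)) ℝ (Fin q)) (f : Fin q → Fin n) :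
    (α fun i => EuclideanSpace.single (f i) (1 : ℝ)) ^ 2 ≤ altNormSq α := by
  by_cases hf : Function.Injective f
  · have hmono : StrictMono (f ∘ Tuple.sort f) :=
      (Tuple.monotone_sort f).strictMono_of_injective (hf.comp (Tuple.sort f).injective)
    have hperm := α.map_perm (fun i => EuclideanSpace.single (f i) (1 : ℝ)) (Tuple.sort f)
    have hsq : (α fun i => EuclideanSpace.single (f i) (1 : ℝ)) ^ 2
        = (α fun i => EuclideanSpace.single ((f ∘ Tuple.sort f) i) (1 : ℝ)) ^ 2 := by
      change α (fun i => EuclideanSpace.single ((f ∘ Tuple.sort f) i) (1 : ℝ)) = _ at hperm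
      rw [hperm]
      rcases Int.units_eq_one_or (Equiv.Perm.sign (Tuple.sort f)) with h | h <;> simp [h]
    rw [hsq]
    exact Finset.single_le_sum
      (f := fun g : Fin q → Fin n => (α fun i => EuclideanSpace.single (g i) (1 : ℝ)) ^ 2)
      (fun _ _ => sq_nonneg _) (by simpa using fun i j hij => hmono hij)
  · obtain ⟨i, j, hij, hne⟩ : ∃ i j, f i = f j ∧ i ≠ j := by
      simpa [Function.Injective] using hf
    rw [α.map_eq_zero_of_eq _ (by rw [hij]) hne]
    simpa using altNormSq_nonneg α

lemma contrNormSq_nonneg (u : EuclideanSpace ℝ (Fin n))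
    (α : AlternatingMap ℝ (EuclideanSpace ℝ (Fin n)) ℝ (Fin q)) :
    0 ≤ contrNormSq u α :=
  Finset.sum_nonneg fun _ _ => sq_nonneg _

/-- The components of the contraction `u⌟α` are linear combinations of the components of `α`. -/
lemma contrNormSq_eq_sum (hq : 1 ≤ q) (u : EuclideanSpace ℝ (Fin n))
    (α : AlternatingMap ℝ (EuclideanSpace ℝ (Fin n)) ℝ (Fin q)) :
    contrNormSq u α = ∑ g ∈ Finset.univ.filter
      (fun g : Fin (q - 1) → Fin n => ∀ i j : Fin (q - 1), i < j → g i < g j),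
      (∑ k, u k * α fun i : Fin q => EuclideanSpace.single (if h : (i : ℕ) = 0 then k
        else g ⟨(i : ℕ) - 1, by have := i.isLt; omega⟩) (1 : ℝ)) ^ 2 := by
  refine Finset.sum_congr rfl fun g _ => ?_
  congr 1
  set w : EuclideanSpace ℝ (Fin n) → Fin q → EuclideanSpace ℝ (Fin n) := fun v i =>
    if h : (i : ℕ) = 0 then v
      else EuclideanSpace.single (g ⟨(i : ℕ) - 1, by have := i.isLt; omega⟩) (1 : ℝ) with hw
  have hupd : ∀ v, w v = Function.update (w 0) ⟨0, hq⟩ v := by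
    intro v
    ext1 i
    by_cases hi : (i : ℕ) = 0
    · obtain rfl : i = ⟨0, hq⟩ := Fin.ext hi
      simp [hw]
    · rw [Function.update_of_ne (by simpa [Fin.ext_iff] using hi)]
      simp [hw, hi]
  have hu : u = ∑ k, u k • EuclideanSpace.single k (1 : ℝ) := by
    simpa using ((EuclideanSpace.basisFun (Fin n) ℝ).sum_repr u).symm
  change α (w u) = _
  conv_lhs => rw [hupd, hu]
  rw [α.map_update_sum]
  refine Finset.sum_congr rfl fun k _ => ?_
  rw [α.map_update_smul, ← hupd, smul_eq_mul]
  congr 2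
  ext1 i
  by_cases hi : (i : ℕ) = 0 <;> simp [hw, hi]

/-- Contraction with a vector of length at most one is bounded with respect to the norms of
forms. -/
lemma contrNormSq_le (hq : 1 ≤ q) {u : EuclideanSpace ℝ (Fin n)} (hu : ‖u‖ ≤ 1)
    (α : AlternatingMap ℝ (EuclideanSpace ℝ (Fin n)) ℝ (Fin q)) :
    contrNormSq u α ≤ (n : ℝ) ^ (q - 1) * n * altNormSq α := by
  rw [contrNormSq_eq_sum hq]
  have hu2 : ∑ k, u k ^ 2 ≤ 1 := by
    rw [← EuclideanSpace.real_norm_sq_eq]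
    exact pow_le_one₀ (norm_nonneg u) hu
  have hterm : ∀ g : Fin (q - 1) → Fin n,
      (∑ k, u k * α fun i : Fin q => EuclideanSpace.single (if h : (i : ℕ) = 0 then k
        else g ⟨(i : ℕ) - 1, by have := i.isLt; omega⟩) (1 : ℝ)) ^ 2 ≤ n * altNormSq α := by
    intro g
    refine (Finset.sum_mul_sq_le_sq_mul_sq _ _ _).trans ?_
    refine (mul_le_of_le_one_left (Finset.sum_nonneg fun _ _ => sq_nonneg _) hu2).trans ?_
    refine (Finset.sum_le_card_nsmul _ _ _
      fun k _ => sq_apply_single_le_altNormSq α _).trans_eq ?_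
    simp
  refine (Finset.sum_le_card_nsmul _ _ _ fun g _ => hterm g).trans ?_
  rw [nsmul_eq_mul, mul_assoc]
  refine mul_le_mul_of_nonneg_right ?_ (mul_nonneg n.cast_nonneg (altNormSq_nonneg α))
  have hcard : (Finset.univ.filter
      (fun g : Fin (q - 1) → Fin n => ∀ i j : Fin (q - 1), i < j → g i < g j)).card
      ≤ n ^ (q - 1) := (Finset.card_filter_le _ _).trans (by simp)
  exact_mod_cast hcard

variable {X : Type*} [MeasurableSpace X]
  {ω : X → AlternatingMap ℝ (EuclideanSpace ℝ (Fin n)) ℝ (Fin q)}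

lemma measurable_altNormSq
    (hω : ∀ v : Fin q → EuclideanSpace ℝ (Fin n), Measurable fun x => ω x v) :
    Measurable fun x => altNormSq (ω x) :=
  Finset.measurable_sum _ fun _ _ => (hω _).pow_const 2

lemma measurable_contrNormSq (hq : 1 ≤ q) {u : X → EuclideanSpace ℝ (Fin n)} (hu : Measurable u)
    (hω : ∀ v : Fin q → EuclideanSpace ℝ (Fin n), Measurable fun x => ω x v) :
    Measurable fun x => contrNormSq (u x) (ω x) := by
  simp_rw [contrNormSq_eq_sum hq]
  refine Finset.measurable_sum _ fun g _ => (Finset.measurable_sum _ fun k _ => ?_).pow_const 2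
  exact Measurable.mul (by fun_prop) (hω _)

end Algebra

/-- For a nonincreasing density `ρ ≥ 0`, one has `s ρ(s) ≤ e(s)`. -/
lemma mul_le_hodgeE {ρ : ℝ → ℝ} (hρC1 : ContDiff ℝ 1 ρ)
    (hρ' : ∀ s : ℝ, 0 ≤ s → deriv ρ s ≤ 0) {s : ℝ} (hs : 0 ≤ s) : s * ρ s ≤ hodgeE ρ s := by
  have hanti : AntitoneOn ρ (Set.Ici 0) :=
    antitoneOn_of_deriv_nonpos (convex_Ici 0) hρC1.continuous.continuousOn
      (hρC1.differentiable one_ne_zero).differentiableOn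
      fun x hx => hρ' x (interior_subset hx)
  have h := intervalIntegral.integral_mono_on hs (μ := volume)
    (intervalIntegrable_const (c := ρ s)) (hρC1.continuous.intervalIntegrable 0 s)
    fun x hx => hanti hx.1 hs hx.2
  simpa [hodgeE] using h

/-- Radial cutoff profiles: smooth, nonnegative and nonincreasing functions of the radius, vanishing
near and beyond `1`. -/
def IsRadialCutoff (η : ℝ → ℝ) : Prop :=
  ContDiff ℝ (⊤ : ℕ∞) η ∧ (∀ r : ℝ, 0 ≤ r → 0 ≤ η r) ∧ AntitoneOn η (Set.Ici (0 : ℝ)) ∧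
    ∃ a : ℝ, a < 1 ∧ ∀ r : ℝ, a ≤ r → η r = 0

section Radial

variable {E : Type*} [NormedAddCommGroup E] [ProperSpace E] [MeasurableSpace E] [BorelSpace E]
  {μ : Measure E} {e : E → ℝ}

lemma integrableOn_mul_radial (he : IntegrableOn e (ball 0 1) μ) {g : ℝ → ℝ} (hg : Continuous g) :
    IntegrableOn (fun x => e x * g ‖x‖) (ball 0 1) μ :=
  he.mul_continuousOn_of_subset (K := closedBall 0 1) (by fun_prop) measurableSet_ball
    (isCompact_closedBall 0 1) ball_subset_closedBall

/-- The derivative of a smoothly truncated energy with respect to the radius. -/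
lemma hasDerivAt_integral_mul_comp_div (he : IntegrableOn e (ball 0 1) μ) {h : ℝ → ℝ}
    (hh : ContDiff ℝ 1 h) {t : ℝ} (ht : 0 < t) :
    HasDerivAt (fun τ => ∫ x in ball 0 1, e x * h (‖x‖ / τ) ∂μ)
      (∫ x in ball 0 1, e x * (deriv h (‖x‖ / t) * (-‖x‖ / t ^ 2)) ∂μ) t := by
  have hd : Continuous (deriv h) := hh.continuous_deriv le_rfl
  have hcont : ContinuousOn (fun p : ℝ × ℝ => deriv h (p.1 / p.2) * (-p.1 / p.2 ^ 2))
      (Set.Icc 0 1 ×ˢ Set.Icc (t / 2) (2 * t)) := by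
    have hne : ∀ p ∈ Set.Icc (0 : ℝ) 1 ×ˢ Set.Icc (t / 2) (2 * t), p.2 ≠ 0 := fun p hp =>
      (lt_of_lt_of_le (half_pos ht) hp.2.1).ne'
    refine ContinuousOn.mul (hd.comp_continuousOn
      (continuousOn_fst.div continuousOn_snd hne)) ?_
    exact continuousOn_fst.neg.div (continuousOn_snd.pow 2) fun p hp => pow_ne_zero 2 (hne p hp)
  obtain ⟨C, hC⟩ := (isCompact_Icc.prod isCompact_Icc).exists_bound_of_continuousOn hcont
  have hs : Set.Icc (t / 2) (2 * t) ∈ 𝓝 t := Icc_mem_nhds (by linarith) (by linarith)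
  refine (hasDerivAt_integral_of_dominated_loc_of_deriv_le (bound := fun x => ‖e x‖ * C)
    (F' := fun τ x => e x * (deriv h (‖x‖ / τ) * (-‖x‖ / τ ^ 2))) hs
    (Eventually.of_forall fun τ => ?_) ?_ ?_ ?_ (he.norm.mul_const C) ?_).2
  · exact (integrableOn_mul_radial he
      (hh.continuous.comp (continuous_id.div_const τ))).aestronglyMeasurable
  · exact integrableOn_mul_radial he (hh.continuous.comp (continuous_id.div_const t))
  · exact (integrableOn_mul_radial he (g := fun r => deriv h (r / t) * (-r / t ^ 2))
      (by fun_prop)).aestronglyMeasurable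
  · refine ae_restrict_of_forall_mem measurableSet_ball fun x hx τ hτ => ?_
    rw [norm_mul]
    exact mul_le_mul_of_nonneg_left
      (hC (‖x‖, τ) ⟨⟨norm_nonneg x, (mem_ball_zero_iff.1 hx).le⟩, hτ⟩) (norm_nonneg _)
  · refine ae_restrict_of_forall_mem measurableSet_ball fun x hx τ hτ => ?_
    have hτ0 : τ ≠ 0 := (lt_of_lt_of_le (half_pos ht) hτ.1).ne'
    have h1 : HasDerivAt (fun τ : ℝ => ‖x‖ / τ) (-‖x‖ / τ ^ 2) τ := by
      simpa only [div_eq_mul_inv, mul_neg, neg_mul] using (hasDerivAt_inv hτ0).const_mul ‖x‖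
    exact ((hh.differentiable one_ne_zero _).hasDerivAt.comp τ h1).const_mul (e x)

/-- A family of smooth cutoffs increasing to the indicator function of `(-∞, 1)`. -/
lemma exists_cutoff_tendsto_indicator : ∃ h : ℕ → ℝ → ℝ,
    (∀ k, ContDiff ℝ (⊤ : ℕ∞) (h k)) ∧ (∀ k t, h k t ∈ Set.Icc (0 : ℝ) 1) ∧
    (∀ k, Antitone (h k)) ∧ (∀ k, ∃ a, 0 < a ∧ a < 1 ∧ ∀ t, a ≤ t → h k t = 0) ∧
    ∀ t, Tendsto (fun k => h k t) atTop (𝓝 (if t < 1 then 1 else 0)) := by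
  refine ⟨fun k t => Real.smoothTransition ((k + 2) * (1 - t) - 1), fun k => ?_,
    fun k t => ⟨Real.smoothTransition.nonneg _, Real.smoothTransition.le_one _⟩,
    fun k s t hst => ?_, fun k => ?_, fun t => ?_⟩
  · exact Real.smoothTransition.contDiff.comp (by fun_prop)
  · refine Real.smoothTransition.monotone ?_
    gcongr
  · have hk : (0 : ℝ) < k + 2 := by positivity
    refine ⟨1 - 1 / (k + 2), ?_, by have := one_div_pos.2 hk; linarith, fun t ht => ?_⟩
    · rw [sub_pos, div_lt_one hk]
      linarith [k.cast_nonneg (α := ℝ)]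
    · refine Real.smoothTransition.zero_of_nonpos ?_
      have : (k + 2) * (1 - t) ≤ (k + 2) * (1 / (k + 2) : ℝ) := by
        gcongr
        linarith
      rw [mul_one_div_cancel hk.ne'] at this
      linarith
  · by_cases ht : t < 1
    · simp only [ht, if_true]
      refine tendsto_const_nhds.congr' ?_
      filter_upwards [eventually_ge_atTop ⌈2 / (1 - t)⌉₊] with k hk
      refine (Real.smoothTransition.one_of_one_le ?_).symm
      have h1 : 2 / (1 - t) ≤ k := Nat.ceil_le.1 hk
      rw [div_le_iff₀ (by linarith)] at h1
      nlinarith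
    · simp only [ht, if_false]
      refine tendsto_const_nhds.congr fun k => (Real.smoothTransition.zero_of_nonpos ?_).symm
      have : (k + 2 : ℝ) * (1 - t) ≤ 0 :=
        mul_nonpos_of_nonneg_of_nonpos (by positivity) (by linarith)
      linarith

/-- A differential inequality tested against all radial cutoffs gives monotonicity of the
normalized energy on balls. -/
lemma div_pow_integral_ball_mono (he : IntegrableOn e (ball 0 1) μ) (m : ℕ)
    (H : ∀ η : ℝ → ℝ, IsRadialCutoff η →
      ∫ x in ball 0 1, e x * (m * η ‖x‖ + ‖x‖ * deriv η ‖x‖) ∂μ ≤ 0)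
    {r₁ r₂ : ℝ} (h₁ : 0 < r₁) (h₁₂ : r₁ ≤ r₂) (h₂ : r₂ ≤ 1) :
    (∫ x in ball 0 r₁, e x ∂μ) / r₁ ^ m ≤ (∫ x in ball 0 r₂, e x ∂μ) / r₂ ^ m := by
  obtain ⟨h, hsm, hmem, hanti, hzero, hlim⟩ := exists_cutoff_tendsto_indicator
  have hT : ∀ r, 0 < r → r ≤ 1 →
      Tendsto (fun k => ∫ x in ball 0 1, e x * h k (‖x‖ / r) ∂μ) atTop
        (𝓝 (∫ x in ball 0 r, e x ∂μ)) := by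
    intro r hr hr1
    have hind : ∫ x in ball 0 r, e x ∂μ
        = ∫ x in ball 0 1, e x * (if ‖x‖ / r < 1 then 1 else 0) ∂μ := by
      rw [← Set.inter_eq_self_of_subset_right (ball_subset_ball (x := (0 : E)) hr1),
        ← setIntegral_indicator measurableSet_ball]
      refine integral_congr_ae (Eventually.of_forall fun x => ?_)
      simp [Set.indicator, div_lt_one hr]
    rw [hind]
    refine tendsto_integral_of_dominated_convergence (fun x => ‖e x‖) (fun k => ?_) he.norm
      (fun k => Eventually.of_forall fun x => ?_)
      (Eventually.of_forall fun x => (hlim _).const_mul _)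
    · exact (integrableOn_mul_radial he
        ((hsm k).continuous.comp (continuous_id.div_const r))).aestronglyMeasurable
    · rw [norm_mul]
      refine mul_le_of_le_one_right (norm_nonneg _) ?_
      rw [Real.norm_of_nonneg (hmem k _).1]
      exact (hmem k _).2
  have h₀ : 0 < r₂ := h₁.trans_le h₁₂
  refine le_of_tendsto_of_tendsto' ((hT r₁ h₁ (h₁₂.trans h₂)).div_const _)
    ((hT r₂ h₀ h₂).div_const _) fun k => ?_
  have hC1 : ContDiff ℝ 1 (h k) := (hsm k).of_le (by exact_mod_cast le_top)
  have hder : ∀ t, 0 < t → HasDerivAt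
      (fun τ => (∫ x in ball 0 1, e x * h k (‖x‖ / τ) ∂μ) / τ ^ m) _ t := fun t ht =>
    (hasDerivAt_integral_mul_comp_div he hC1 ht).div (hasDerivAt_pow m t) (pow_pos ht m).ne'
  refine monotoneOn_of_deriv_nonneg (convex_Icc r₁ r₂)
    (fun t ht => (hder t (h₁.trans_le ht.1)).continuousAt.continuousWithinAt)
    (fun t ht => (hder t (h₁.trans_le (interior_subset ht).1)).differentiableAt
      |>.differentiableWithinAt) (fun t ht => ?_)
    (Set.left_mem_Icc.2 h₁₂) (Set.right_mem_Icc.2 h₁₂) h₁₂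
  have ht' := interior_subset ht
  have ht0 : 0 < t := h₁.trans_le ht'.1
  rw [(hder t ht0).deriv]
  have hcut : IsRadialCutoff fun r => h k (r / t) := by
    refine ⟨(hsm k).comp (contDiff_id.div_const t), fun r _ => (hmem k _).1,
      fun r _ s _ hrs => hanti k (by gcongr), ?_⟩
    obtain ⟨a, ha0, ha1, ha⟩ := hzero k
    refine ⟨a, ha1, fun r hr => ha _ (hr.trans ?_)⟩
    exact le_div_self (ha0.le.trans hr) ht0 (ht'.2.trans h₂)
  have hI := H _ hcut
  have hdη : ∀ r, deriv (fun r => h k (r / t)) r = deriv (h k) (r / t) / t := fun r =>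
    ((hC1.differentiable one_ne_zero _).hasDerivAt.comp r
      ((hasDerivAt_id r).div_const t)).deriv.trans (mul_one_div _ _)
  have hd : Continuous (deriv (h k)) := hC1.continuous_deriv le_rfl
  have hsplit : ∫ x in ball 0 1, e x * (m * h k (‖x‖ / t)
        + ‖x‖ * deriv (fun r => h k (r / t)) ‖x‖) ∂μ
      = m * (∫ x in ball 0 1, e x * h k (‖x‖ / t) ∂μ)
        - t * ∫ x in ball 0 1, e x * (deriv (h k) (‖x‖ / t) * (-‖x‖ / t ^ 2)) ∂μ := by
    rw [← integral_const_mul, ← integral_const_mul, ← integral_sub]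
    · refine integral_congr_ae (Eventually.of_forall fun x => ?_)
      simp only [hdη]
      field_simp
      ring
    · exact (integrableOn_mul_radial he
        ((hsm k).continuous.comp (continuous_id.div_const t))).const_mul _
    · exact (integrableOn_mul_radial he (g := fun r => deriv (h k) (r / t) * (-r / t ^ 2))
        (by fun_prop)).const_mul _
  rw [hsplit] at hI
  refine div_nonneg ?_ (by positivity)
  rcases m.eq_zero_or_pos with rfl | hm
  · simp only [Nat.cast_zero, zero_mul, zero_sub, Left.neg_nonpos_iff] at hI
    simpa using (mul_nonneg_iff_of_pos_left ht0).1 hI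
  · have hpow : t ^ m = t ^ (m - 1) * t := (pow_sub_one_mul hm.ne' t).symm
    have := mul_nonneg (pow_pos ht0 (m - 1)).le (neg_nonneg.2 hI)
    rw [hpow]
    linarith

/-- Smooth cutoffs vanishing near the origin and increasing to one on the positive half-line, for
which `r ζ'(r)` stays uniformly bounded. -/
lemma exists_cutoff_vanishing_near_zero : ∃ (ζ : ℕ → ℝ → ℝ) (M : ℝ),
    (∀ k, ContDiff ℝ (⊤ : ℕ∞) (ζ k)) ∧ (∀ k r, ζ k r ∈ Set.Icc (0 : ℝ) 1) ∧
    (∀ k, ∃ a, 0 < a ∧ ∀ r, r ≤ a → ζ k r = 0) ∧ (∀ k, ∃ b, 0 < b ∧ ∀ r, b ≤ r → ζ k r = 1) ∧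
    (∀ k, Monotone (ζ k)) ∧ (∀ k r, |r * deriv (ζ k) r| ≤ M) ∧
    ∀ r, 0 < r → ∀ᶠ k in atTop, ζ k r = 1 ∧ deriv (ζ k) r = 0 := by
  set s := Real.smoothTransition with hs
  have hs1 : ContDiff ℝ 1 s := Real.smoothTransition.contDiff
  have hd0 : ∀ y, y < 0 → deriv s y = 0 := fun y hy => by
    have : s =ᶠ[𝓝 y] fun _ => 0 := by
      filter_upwards [gt_mem_nhds hy] with z hz
      exact Real.smoothTransition.zero_of_nonpos hz.le
    rw [this.deriv_eq, deriv_const]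
  have hd1 : ∀ y, 1 < y → deriv s y = 0 := fun y hy => by
    have : s =ᶠ[𝓝 y] fun _ => 1 := by
      filter_upwards [lt_mem_nhds hy] with z hz
      exact Real.smoothTransition.one_of_one_le hz.le
    rw [this.deriv_eq, deriv_const]
  have hcont : Continuous fun y => (y + 1) * deriv s y :=
    (continuous_id.add continuous_const).mul (hs1.continuous_deriv le_rfl)
  obtain ⟨M, hM⟩ := (isCompact_Icc (a := (0 : ℝ)) (b := 1)).exists_bound_of_continuousOn
    hcont.continuousOn
  have hM' : ∀ y, |(y + 1) * deriv s y| ≤ M := by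
    intro y
    have hM0 : 0 ≤ M := (norm_nonneg _).trans (hM 0 (by simp))
    rcases lt_or_ge y 0 with h | h
    · simpa [hd0 y h] using hM0
    rcases lt_or_ge 1 y with h' | h'
    · simpa [hd1 y h'] using hM0
    · exact hM y ⟨h, h'⟩
  have hder : ∀ (k : ℕ) r,
      deriv (fun r => s ((k + 1) * r - 1)) r = (k + 1) * deriv s ((k + 1) * r - 1) := by
    intro k r
    have h1 : HasDerivAt (fun r : ℝ => (k + 1 : ℝ) * r - 1) (k + 1) r := by
      simpa using ((hasDerivAt_id r).const_mul (k + 1 : ℝ)).sub_const 1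
    exact ((hs1.differentiable one_ne_zero _).hasDerivAt.comp r h1).deriv.trans (mul_comm _ _)
  refine ⟨fun k r => s ((k + 1) * r - 1), M, fun k => ?_,
    fun k r => ⟨Real.smoothTransition.nonneg _, Real.smoothTransition.le_one _⟩,
    fun k => ⟨1 / (k + 1), by positivity, fun r hr => ?_⟩,
    fun k => ⟨2 / (k + 1), by positivity, fun r hr => ?_⟩, fun k r t hrt => ?_, fun k r => ?_,
    fun r hr => ?_⟩
  · exact Real.smoothTransition.contDiff.comp (by fun_prop)
  · rw [le_div_iff₀ (by positivity)] at hr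
    exact Real.smoothTransition.zero_of_nonpos (by linarith)
  · rw [div_le_iff₀ (by positivity)] at hr
    exact Real.smoothTransition.one_of_one_le (by linarith)
  · exact Real.smoothTransition.monotone (by gcongr)
  · rw [hder]
    convert hM' ((k + 1) * r - 1) using 2
    ring
  · filter_upwards [eventually_ge_atTop ⌈2 / r⌉₊] with k hk
    have h1 : 2 / r ≤ k := Nat.ceil_le.1 hk
    rw [div_le_iff₀ hr] at h1
    refine ⟨Real.smoothTransition.one_of_one_le (by linarith), ?_⟩
    rw [hder, hd1 _ (by linarith), mul_zero]

/-- In the limit of cutoffs shrinking to the origin, the first-variation identity away from the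
origin gives a differential inequality tested against all radial cutoffs. -/
lemma integral_mul_radial_nonpos_of_stationary [NullSingletonClass μ]
    (he : IntegrableOn e (ball 0 1) μ) {P R : E → ℝ} {K c d : ℝ} (hc : 0 ≤ c)
    (hPm : AEStronglyMeasurable P (μ.restrict (ball 0 1)))
    (hRm : AEStronglyMeasurable R (μ.restrict (ball 0 1)))
    (hP0 : ∀ x, 0 ≤ P x) (hP : ∀ x, P x ≤ e x) (hR0 : ∀ x, 0 ≤ R x) (hR : ∀ x, R x ≤ K * e x)
    {η : ℝ → ℝ} (hη : IsRadialCutoff η)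
    (H : ∀ ζ : ℝ → ℝ, ContDiff ℝ (⊤ : ℕ∞) ζ → (∀ r : ℝ, ζ r ∈ Set.Icc (0:ℝ) 1) →
      (∃ a : ℝ, 0 < a ∧ ∀ r : ℝ, r ≤ a → ζ r = 0) →
      (∃ b : ℝ, 0 < b ∧ ∀ r : ℝ, b ≤ r → ζ r = 1) →
      ∫ x in ball 0 1, e x *
          (d * (ζ ‖x‖ * η ‖x‖) + ‖x‖ * deriv (fun r => ζ r * η r) ‖x‖) ∂μ
        = c * (∫ x in ball 0 1, P x * (ζ ‖x‖ * η ‖x‖) ∂μ)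
          + c * ∫ x in ball 0 1, R x * (‖x‖ * deriv (fun r => ζ r * η r) ‖x‖) ∂μ) :
    ∫ x in ball 0 1, e x * ((d - c) * η ‖x‖ + ‖x‖ * deriv η ‖x‖) ∂μ ≤ 0 := by
  obtain ⟨ζ, M, hsm, hmem, hzero, hone, hmono, hM, hlim⟩ := exists_cutoff_vanishing_near_zero
  obtain ⟨hηsm, hη0, hηanti, -⟩ := hη
  have hη1 : ContDiff ℝ 1 η := hηsm.of_le (by exact_mod_cast le_top)
  have hη' : Continuous (deriv η) := hη1.continuous_deriv le_rfl
  have hPint : IntegrableOn P (ball 0 1) μ := he.mono' hPm <| Eventually.of_forall fun x => by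
    simpa [abs_of_nonneg (hP0 x)] using hP x
  have hRint : IntegrableOn R (ball 0 1) μ :=
    (he.const_mul K).mono' hRm <| Eventually.of_forall fun x => by
      simpa [abs_of_nonneg (hR0 x)] using hR x
  have hζ' : ∀ k, Continuous (deriv (ζ k)) := fun k =>
    ((hsm k).of_le (by exact_mod_cast le_top : (1 : WithTop ℕ∞) ≤ _)).continuous_deriv le_rfl
  have hprod : ∀ k r, deriv (fun r => ζ k r * η r) r = deriv (ζ k) r * η r + ζ k r * deriv η r :=
    fun k r => ((((hsm k).differentiable (by simp)) r).hasDerivAt.mul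
      ((hη1.differentiable one_ne_zero) r).hasDerivAt).deriv
  set G : ℕ → ℝ → ℝ := fun k r => (d - c) * (ζ k r * η r) + r * (ζ k r * deriv η r)
    + (1 - c * K) * (r * deriv (ζ k) r * η r) with hG
  have hζc : ∀ k, Continuous (ζ k) := fun k => (hsm k).continuous
  have hηc : Continuous η := hη1.continuous
  have hGc : ∀ k, Continuous (G k) := fun k => by
    have := hζc k
    have := hζ' k
    fun_prop
  have hle : ∀ k, ∫ x in ball 0 1, e x * G k ‖x‖ ∂μ ≤ 0 := by
    intro k
    have := hζc k
    have := hζ' k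
    have hk := H (ζ k) (hsm k) (hmem k) (hzero k) (hone k)
    simp only [hprod] at hk
    have iL := integrableOn_mul_radial he (g := fun r => d * (ζ k r * η r)
      + r * (deriv (ζ k) r * η r + ζ k r * deriv η r)) (by fun_prop)
    have iP := (integrableOn_mul_radial hPint (g := fun r => ζ k r * η r)
      (by fun_prop)).const_mul c
    have iR := (integrableOn_mul_radial hRint
      (g := fun r => r * (deriv (ζ k) r * η r + ζ k r * deriv η r)) (by fun_prop)).const_mul c
    rw [← integral_const_mul, ← integral_const_mul, ← sub_eq_zero, ← integral_add' iP iR,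
      ← integral_sub' iL (iP.add iR)] at hk
    rw [← hk]
    refine setIntegral_mono_on (integrableOn_mul_radial he (hGc k)) (iL.sub (iP.add iR))
      measurableSet_ball fun x _ => ?_
    have hr := norm_nonneg x
    have hηx := hη0 _ hr
    have hζx := (hmem k ‖x‖).1
    have hdη : deriv η ‖x‖ ≤ 0 := by
      rw [← (hη1.differentiable one_ne_zero _).derivWithin (uniqueDiffOn_Ici 0 _ hr)]
      exact hηanti.derivWithin_nonpos
    have hdζ : 0 ≤ deriv (ζ k) ‖x‖ := (hmono k).deriv_nonneg
    have h1 : c * (P x * (ζ k ‖x‖ * η ‖x‖)) ≤ c * (e x * (ζ k ‖x‖ * η ‖x‖)) := by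
      gcongr
      exact hP x
    have h2 : c * (R x * (‖x‖ * (deriv (ζ k) ‖x‖ * η ‖x‖)))
        ≤ c * (K * e x * (‖x‖ * (deriv (ζ k) ‖x‖ * η ‖x‖))) := by
      gcongr
      exact hR x
    have h3 : c * (R x * (‖x‖ * (ζ k ‖x‖ * deriv η ‖x‖))) ≤ 0 :=
      mul_nonpos_of_nonneg_of_nonpos hc <| mul_nonpos_of_nonneg_of_nonpos (hR0 x) <|
        mul_nonpos_of_nonneg_of_nonpos hr <| mul_nonpos_of_nonneg_of_nonpos hζx hdη
    simp only [hG, Pi.sub_apply, Pi.add_apply]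
    linarith
  obtain ⟨A, hA⟩ := (isCompact_Icc (a := (0 : ℝ)) (b := 1)).exists_bound_of_continuousOn
    hηc.continuousOn
  obtain ⟨B, hB⟩ := (isCompact_Icc (a := (0 : ℝ)) (b := 1)).exists_bound_of_continuousOn
    hη'.continuousOn
  refine le_of_tendsto' (tendsto_integral_of_dominated_convergence
    (fun x => ‖e x‖ * (|d - c| * A + B + |1 - c * K| * (M * A)))
    (fun k => (integrableOn_mul_radial he (hGc k)).aestronglyMeasurable)
    (he.norm.mul_const _) (fun k => ?_) ?_) hle
  · refine ae_restrict_of_forall_mem measurableSet_ball fun x hx => ?_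
    have hx' : ‖x‖ ∈ Set.Icc (0 : ℝ) 1 := ⟨norm_nonneg x, (mem_ball_zero_iff.1 hx).le⟩
    have hAx : |η ‖x‖| ≤ A := hA _ hx'
    have hBx : |deriv η ‖x‖| ≤ B := hB _ hx'
    have hζx : |ζ k ‖x‖| ≤ 1 := abs_le.2 ⟨by linarith [(hmem k ‖x‖).1], (hmem k ‖x‖).2⟩
    have hMx := hM k ‖x‖
    have hA0 := (abs_nonneg _).trans hAx
    have hM0 := (abs_nonneg _).trans hMx
    rw [norm_mul]
    refine mul_le_mul_of_nonneg_left ?_ (norm_nonneg _)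
    refine (norm_add₃_le).trans (add_le_add_three ?_ ?_ ?_)
    · rw [norm_mul, norm_mul]
      exact mul_le_mul_of_nonneg_left
        ((mul_le_mul hζx hAx (abs_nonneg _) zero_le_one).trans_eq (one_mul A)) (norm_nonneg _)
    · rw [norm_mul, norm_mul, norm_norm]
      refine (mul_le_of_le_one_left (by positivity) hx'.2).trans ?_
      exact (mul_le_mul hζx hBx (abs_nonneg _) zero_le_one).trans_eq (one_mul B)
    · rw [norm_mul, norm_mul]
      exact mul_le_mul_of_nonneg_left (mul_le_mul hMx hAx (abs_nonneg _) hM0) (norm_nonneg _)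
  · have h0 : ∀ᵐ x ∂μ, x ∉ ({0} : Set E) := measure_eq_zero_iff_ae_notMem.1 (measure_singleton 0)
    filter_upwards [ae_restrict_of_ae h0] with x hx
    refine tendsto_const_nhds.congr' ?_
    filter_upwards [hlim ‖x‖ (norm_pos_iff.2 hx)] with k hk
    simp [hG, hk.1, hk.2]

end Radial

/-- conformal monotonicity in the presence of a point singularity at the
origin: the first-variation identity is only assumed for radial test functions
`φ = ζ·η` vanishing near the origin, and the monotonicity formula still holds. -/
theorem stmt_13 (n q : ℕ) (hq : 1 ≤ q) (hn : 2 * q < n)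
    (Ω : Set (EuclideanSpace ℝ (Fin n))) (hΩopen : IsOpen Ω)
    (hΩball : closedBall (0 : EuclideanSpace ℝ (Fin n)) 1 ⊆ Ω)
    (ρ : ℝ → ℝ) (hρC1 : ContDiff ℝ 1 ρ)
    (hρ0 : ∀ s : ℝ, 0 ≤ s → 0 ≤ ρ s)
    (hρ' : ∀ s : ℝ, 0 ≤ s → deriv ρ s ≤ 0)
    (ω : EuclideanSpace ℝ (Fin n) → AlternatingMap ℝ (EuclideanSpace ℝ (Fin n)) ℝ (Fin q))
    (hωmeas : ∀ v : Fin q → EuclideanSpace ℝ (Fin n), Measurable fun x => ω x v)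
    (hint : IntegrableOn (fun x => hodgeE ρ (altNormSq (ω x)))
      (ball (0 : EuclideanSpace ℝ (Fin n)) 1) volume)
    (hstat : ∀ η ζ : ℝ → ℝ, ContDiff ℝ (⊤ : ℕ∞) η → (∀ r : ℝ, 0 ≤ r → 0 ≤ η r) →
      AntitoneOn η (Set.Ici (0:ℝ)) → (∃ a : ℝ, a < 1 ∧ ∀ r : ℝ, a ≤ r → η r = 0) →
      ContDiff ℝ (⊤ : ℕ∞) ζ → (∀ r : ℝ, ζ r ∈ Set.Icc (0:ℝ) 1) →
      (∃ a : ℝ, 0 < a ∧ ∀ r : ℝ, r ≤ a → ζ r = 0) →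
      (∃ b : ℝ, 0 < b ∧ ∀ r : ℝ, b ≤ r → ζ r = 1) →
      (∫ x in ball (0 : EuclideanSpace ℝ (Fin n)) 1,
          hodgeE ρ (altNormSq (ω x)) *
            (n * (ζ ‖x‖ * η ‖x‖) + ‖x‖ * deriv (fun r => ζ r * η r) ‖x‖))
        = 2 * q * (∫ x in ball (0 : EuclideanSpace ℝ (Fin n)) 1,
              altNormSq (ω x) * ρ (altNormSq (ω x)) * (ζ ‖x‖ * η ‖x‖))
          + 2 * q * ∫ x in ball (0 : EuclideanSpace ℝ (Fin n)) 1,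
              ρ (altNormSq (ω x)) * ‖x‖ * deriv (fun r => ζ r * η r) ‖x‖ *
                contrNormSq (‖x‖⁻¹ • x) (ω x)) :
    ∀ r₁ r₂ : ℝ, 0 < r₁ → r₁ < r₂ → r₂ ≤ 1 →
      r₁ ^ ((2 * q : ℤ) - n) *
          (∫ x in ball (0 : EuclideanSpace ℝ (Fin n)) r₁, hodgeE ρ (altNormSq (ω x)))
        ≤ r₂ ^ ((2 * q : ℤ) - n) *
            ∫ x in ball (0 : EuclideanSpace ℝ (Fin n)) r₂, hodgeE ρ (altNormSq (ω x)) := by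
  intro r₁ r₂ h₁ h₁₂ h₂
  set Q : EuclideanSpace ℝ (Fin n) → ℝ := fun x => altNormSq (ω x) with hQ
  have hQ0 : ∀ x, 0 ≤ Q x := fun x => altNormSq_nonneg _
  have hQm : Measurable Q := measurable_altNormSq hωmeas
  have hρQm : Measurable fun x => ρ (Q x) := hρC1.continuous.measurable.comp hQm
  have hu : ∀ x : EuclideanSpace ℝ (Fin n), ‖‖x‖⁻¹ • x‖ ≤ 1 := fun x => by
    rw [norm_smul, norm_inv, norm_norm]
    exact inv_mul_le_one
  have hCm : Measurable fun x => contrNormSq (‖x‖⁻¹ • x) (ω x) :=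
    measurable_contrNormSq hq (by fun_prop) hωmeas
  have hPe : ∀ x, Q x * ρ (Q x) ≤ hodgeE ρ (Q x) := fun x => mul_le_hodgeE hρC1 hρ' (hQ0 x)
  have : Nonempty (Fin n) := ⟨⟨0, by omega⟩⟩
  have hmono := div_pow_integral_ball_mono hint (n - 2 * q) (fun η hη => by
    have := integral_mul_radial_nonpos_of_stationary (μ := volume) hint
      (P := fun x => Q x * ρ (Q x)) (R := fun x => ρ (Q x) * contrNormSq (‖x‖⁻¹ • x) (ω x))
      (K := (n : ℝ) ^ (q - 1) * n) (c := 2 * q) (d := n) (by positivity)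
      (hQm.mul hρQm).aestronglyMeasurable (hρQm.mul hCm).aestronglyMeasurable
      (fun x => mul_nonneg (hQ0 x) (hρ0 _ (hQ0 x))) hPe
      (fun x => mul_nonneg (hρ0 _ (hQ0 x)) (contrNormSq_nonneg _ _))
      (fun x => by
        calc ρ (Q x) * contrNormSq (‖x‖⁻¹ • x) (ω x)
            ≤ ρ (Q x) * ((n : ℝ) ^ (q - 1) * n * Q x) :=
              mul_le_mul_of_nonneg_left (contrNormSq_le hq (hu x) _) (hρ0 _ (hQ0 x))
          _ = (n : ℝ) ^ (q - 1) * n * (Q x * ρ (Q x)) := by ring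
          _ ≤ (n : ℝ) ^ (q - 1) * n * hodgeE ρ (Q x) :=
              mul_le_mul_of_nonneg_left (hPe x) (by positivity))
      hη (fun ζ hζ hζI hζ0 hζ1 => by
        rw [hstat η ζ hη.1 hη.2.1 hη.2.2.1 hη.2.2.2 hζ hζI hζ0 hζ1]
        congr 3
        ext1 x
        ring)
    simpa [Nat.cast_sub hn.le] using this) h₁ h₁₂.le h₂
  have hexp : ∀ r : ℝ, r ^ ((2 * q : ℤ) - n) = (r ^ (n - 2 * q))⁻¹ := fun r => by
    rw [← zpow_natCast, ← zpow_neg]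
    congr 1
    push_cast [hn.le]
    ring
  rw [hexp, hexp, ← div_eq_inv_mul, ← div_eq_inv_mul]
  exact hmono
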